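/- arXiv:2511.12936 — 7 statements merged into one kernel-verified Lean document; each statement's English description precedes it below -/
import Mathlib

section
/- Let p be a prime, t a positive integer with t ≤ p, and α ∈ ZMod p with α ≠ 0. Let a_1,…,a_t ∈ ZMod p be the coefficients determined by (X − α)^t = X^t + Σ_{k=1}^t a_k X^{t−k}. Given initial values b_0,…,b_{t−1} ∈ ZMod p, let w : ℕ → ZMod p be the sequence defined by w_i = b_i for 0 ≤ i ≤ t − 1 and by the recurrence w_{i+t} = −Σ_{k=1}^t a_k·w_{i+t−k} for i ≥ 0, and let Q be the Lagrange interpolation polynomial over ZMod p through the t points ((i : ZMod p), b_i·α^{−i}) for i = 0,…,t−1. Then w_i = Q(i)·α^i for every i ∈ ℕ (evaluating Q at the image of i in ZMod p). -/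
theorem Polynomial.sum_choose_mul_neg_one_pow_mul_eval_eq_zero {R : Type*} [CommRing R]
    {P : Polynomial R} {n : ℕ} (hP : P.natDegree < n) (x : R) :
    ∑ k ∈ Finset.range (n + 1),
      (n.choose k : R) * (-1) ^ k * P.eval (x + ((n - k : ℕ) : R)) = 0 := by
  have h := congrFun (Polynomial.fwdDiff_iter_eq_zero_of_degree_lt hP) x
  rw [fwdDiff_iter_eq_sum_shift, ← Finset.sum_range_reflect] at h
  refine Eq.trans (Finset.sum_congr rfl fun k hk => ?_) h
  have hk' : k ≤ n := Nat.lt_succ_iff.mp (Finset.mem_range.mp hk)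
  have hsub : n + 1 - 1 - k = n - k := by omega
  rw [hsub, Nat.sub_sub_self hk', Nat.choose_symm hk']
  simp [zsmul_eq_mul, mul_comm]

/-- If `P` has degree less than `n`, the sequence `i ↦ P(i) α ^ i` satisfies the linear recursion
with characteristic polynomial `(X - α) ^ n`. -/
theorem Polynomial.sum_choose_mul_neg_pow_mul_eval_mul_pow_eq_zero {R : Type*} [CommRing R]
    {P : Polynomial R} {n : ℕ} (hP : P.natDegree < n) (α : R) (j : ℕ) :
    ∑ k ∈ Finset.range (n + 1),
      (n.choose k : R) * (-α) ^ k * (P.eval ((j + n - k : ℕ) : R) * α ^ (j + n - k)) = 0 := by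
  have h := congrArg (α ^ (j + n) * ·)
    (Polynomial.sum_choose_mul_neg_one_pow_mul_eval_eq_zero hP (j : R))
  simp only [mul_zero, Finset.mul_sum] at h
  refine Eq.trans (Finset.sum_congr rfl fun k hk => ?_) h
  have hk' : k ≤ n := Nat.lt_succ_iff.mp (Finset.mem_range.mp hk)
  have hpow : α ^ (j + n) = α ^ k * α ^ (j + n - k) := by
    rw [← pow_add]
    congr 1
    omega
  rw [hpow, Nat.add_sub_assoc hk', Nat.cast_add, neg_pow α k]
  ring

/-- Correctness of share distribution: if `w` is defined by initial values
`b_0,…,b_{t−1}` and the homogeneous linear recursion of degree `t` associated with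
`α ≠ 0` (coefficients `a k = C(t,k)·(−α)^k` from `(X − α)^t = X^t + Σ_{k=1}^t a_k X^{t−k}`),
and `Q` is the Lagrange interpolation polynomial through the points
`((i : ZMod p), b_i · α^{−i})` for `i = 0,…,t−1`, then `w i = Q(i) · α^i` for all `i`. -/
theorem share_distribution_correct (p : ℕ) [Fact p.Prime]
    (t : ℕ) (ht : 0 < t) (htp : t ≤ p)
    (α : ZMod p) (hα : α ≠ 0)
    (a : ℕ → ZMod p)
    (ha : ∀ k, 1 ≤ k → k ≤ t → a k = (t.choose k : ZMod p) * (-α) ^ k)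
    (b : ℕ → ZMod p)
    (w : ℕ → ZMod p)
    (hw0 : ∀ i, i < t → w i = b i)
    (hwrec : ∀ i : ℕ, w (i + t) = -∑ k ∈ Finset.Icc 1 t, a k * w (i + t - k))
    (Q : Polynomial (ZMod p))
    (hQ : Q = Lagrange.interpolate (Finset.range t) (fun i : ℕ => (i : ZMod p))
        (fun i : ℕ => b i * (α ^ i)⁻¹)) :
    ∀ i : ℕ, w i = Q.eval (i : ZMod p) * α ^ i := by
  have hinj : Set.InjOn (fun i : ℕ => (i : ZMod p)) (Finset.range t) := by
    intro x hx y hy hxy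
    have hx' : x < p := (Finset.mem_range.mp hx).trans_le htp
    have hy' : y < p := (Finset.mem_range.mp hy).trans_le htp
    exact ((ZMod.natCast_eq_natCast_iff x y p).mp hxy).eq_of_lt_of_lt hx' hy'
  have hdeg : Q.natDegree < t := by
    rcases eq_or_ne Q 0 with h0 | h0
    · simpa [h0] using ht
    · rw [Polynomial.natDegree_lt_iff_degree_lt h0, hQ]
      simpa using Lagrange.degree_interpolate_lt (fun i : ℕ => b i * (α ^ i)⁻¹) hinj
  intro i
  induction i using Nat.strong_induction_on with
  | _ i ih =>
    rcases lt_or_ge i t with hi | hi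
    · rw [hw0 i hi, hQ, Lagrange.eval_interpolate_at_node (v := fun i : ℕ => (i : ZMod p)) _ hinj
        (Finset.mem_range.mpr hi), inv_mul_cancel_right₀ (pow_ne_zero i hα)]
    · obtain ⟨j, rfl⟩ := Nat.exists_eq_add_of_le' hi
      have hsum := Polynomial.sum_choose_mul_neg_pow_mul_eval_mul_pow_eq_zero hdeg α j
      rw [Finset.range_eq_Ico, Finset.sum_eq_sum_Ico_succ_bot t.succ_pos] at hsum
      simp only [Nat.choose_zero_right, Nat.cast_one, pow_zero, one_mul, Nat.sub_zero] at hsum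
      rw [hwrec j, eq_neg_of_add_eq_zero_left hsum, neg_inj]
      refine Finset.sum_congr (by ext; simp [Nat.one_le_iff_ne_zero]) ?_
      intro k hk
      obtain ⟨hk1, hk2⟩ : 1 ≤ k ∧ k < t + 1 := by simpa using hk
      rw [ha k hk1 (Nat.lt_succ_iff.mp hk2), ih (j + t - k) (by omega)]
end

section
/- Let p be a prime, t a positive integer, and α ∈ ZMod p with α ≠ 0. Let Q be a polynomial over ZMod p of degree at most t − 1 and define w : ℕ → ZMod p by w_i = Q(i)·α^i. Let S′ ⊆ ℕ be a finite set of share indices with |S′| = t such that the map j ↦ ((t + j − 1 : ℕ) : ZMod p) is injective on S′. Then the Lagrange interpolation polynomial through the t points (n_j, w_{t+j−1}·α^{−(t+j−1)}) for j ∈ S′, where n_j = ((t + j − 1 : ℕ) : ZMod p), equals Q; consequently, for every i ∈ ℕ, evaluating this interpolation polynomial at (i : ZMod p) and multiplying by α^i yields w_i. In particular any t shares sh_j = w_{t+j−1} recover all the secrets σ_{i+1} = w_i for i = 0,…,m−1. -/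
/-- Correctness of reconstruction: if `w i = Q(i)·α^i` for a polynomial `Q`
of degree at most `t − 1`, and `S′` is a set of `t` share indices whose nodes
`n_j = (t + j − 1 : ZMod p)` are pairwise distinct, then the Lagrange interpolation
polynomial through the points `(n_j, w_{t+j−1}·α^{−(t+j−1)})`, `j ∈ S′`, equals `Q`;
consequently evaluating it at `(i : ZMod p)` and multiplying by `α^i` recovers `w i`
for every `i` — in particular the `t` shares `sh_j = w_{t+j−1}` recover all the
secrets `σ_{i+1} = w_i`. -/
theorem shares_recover_secrets (p : ℕ) [Fact p.Prime]
    (t : ℕ) (ht : 0 < t)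
    (α : ZMod p) (hα : α ≠ 0)
    (Q : Polynomial (ZMod p)) (hQdeg : Q.natDegree ≤ t - 1)
    (w : ℕ → ZMod p) (hw : ∀ i : ℕ, w i = Q.eval (i : ZMod p) * α ^ i)
    (S' : Finset ℕ) (hcard : S'.card = t)
    (hinj : Set.InjOn (fun j : ℕ => ((t + j - 1 : ℕ) : ZMod p)) ↑S') :
    Lagrange.interpolate S' (fun j : ℕ => ((t + j - 1 : ℕ) : ZMod p))
        (fun j : ℕ => w (t + j - 1) * (α ^ (t + j - 1))⁻¹) = Q ∧
    ∀ i : ℕ,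
      (Lagrange.interpolate S' (fun j : ℕ => ((t + j - 1 : ℕ) : ZMod p))
          (fun j : ℕ => w (t + j - 1) * (α ^ (t + j - 1))⁻¹)).eval (i : ZMod p) * α ^ i
        = w i := by
  have hQ : Q.degree < S'.card :=
    Polynomial.degree_le_natDegree.trans_lt (by rw [hcard]; exact_mod_cast by omega)
  have heq := Lagrange.eq_interpolate_of_eval_eq
    (fun j : ℕ => w (t + j - 1) * (α ^ (t + j - 1))⁻¹) hinj hQ fun j _ => by
      simp only [hw, mul_inv_cancel_right₀ (pow_ne_zero _ hα)]
  rw [← heq]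
  exact ⟨rfl, fun i => (hw i).symm⟩
end

section
/- Let p be a prime, n and t positive integers, u = (u_1, u_2) ∈ (ZMod p)², s_1,…,s_n ∈ (ZMod p)², x = (x_1,…,x_n) and y = (y_1,…,y_n) ∈ (ZMod p)^n, and let d = (d_1, d_2) = Σ_{i=1}^n y_i·s_i. Let α ∈ ZMod p with α ≠ 0, and let Q be a polynomial over ZMod p of degree at most t − 1 with Q(0) = d_1 and α·Q(1) = d_2. Let S′ ⊆ ℕ be a finite set with |S′| = t whose nodes n_j = ((t + j − 1 : ℕ) : ZMod p), j ∈ S′, are pairwise distinct, and for e ∈ ZMod p set λ_j(e) = Π_{j′∈S′, j′≠j} (e − n_{j′})/(n_j − n_{j′}). Then Σ_{i=1}^n (u_1·(s_i)_1 + u_2·(s_i)_2 + x_i)·y_i − u_1·Σ_{j∈S′} λ_j(0)·Q(n_j) − u_2·α·Σ_{j∈S′} λ_j(1)·Q(n_j) = Σ_{i=1}^n x_i·y_i. -/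
/-- Lagrange interpolation, evaluated at a point, with explicit Lagrange coefficients. -/
theorem sum_lagrange_coeff_mul_eval {F ι : Type*} [Field F] [DecidableEq ι] {s : Finset ι}
    {v : ι → F} (hv : Set.InjOn v s) {f : Polynomial F} (hf : f.degree < s.card) (e : F) :
    ∑ j ∈ s, (∏ k ∈ s.erase j, (e - v k) / (v j - v k)) * f.eval (v j) = f.eval e := by
  conv_rhs => rw [Lagrange.eq_interpolate hv hf]
  simp only [Lagrange.interpolate_apply, Polynomial.eval_finsetSum, Polynomial.eval_mul,
    Polynomial.eval_C, Lagrange.basis, Polynomial.eval_prod, Lagrange.basisDivisor,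
    Polynomial.eval_sub, Polynomial.eval_X, div_eq_inv_mul]
  exact Finset.sum_congr rfl fun _ _ => mul_comm _ _

/-- Correctness of VTMCFE in the exponent: with `d = (d_1, d_2) = Σ_i y_i·s_i`,
a polynomial `Q` of degree at most `t − 1` with `Q(0) = d_1` and `α·Q(1) = d_2`, and a set
`S′` of `t` indices with pairwise distinct nodes `n_j = (t + j − 1 : ZMod p)` and Lagrange
coefficients `λ_j(e) = Π_{j′∈S′, j′≠j} (e − n_{j′})/(n_j − n_{j′})`, we have
`Σ_i (u_1·(s_i)_1 + u_2·(s_i)_2 + x_i)·y_i − u_1·Σ_j λ_j(0)·Q(n_j)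
  − u_2·α·Σ_j λ_j(1)·Q(n_j) = Σ_i x_i·y_i`. -/
theorem vtmcfe_exponent_correct (p : ℕ) [Fact p.Prime]
    (n t : ℕ) (hn : 0 < n) (ht : 0 < t)
    (u : ZMod p × ZMod p) (s : Fin n → ZMod p × ZMod p)
    (x y : Fin n → ZMod p)
    (d1 d2 : ZMod p)
    (hd1 : d1 = ∑ i, y i * (s i).1) (hd2 : d2 = ∑ i, y i * (s i).2)
    (α : ZMod p) (hα : α ≠ 0)
    (Q : Polynomial (ZMod p)) (hQdeg : Q.natDegree ≤ t - 1)
    (hQ0 : Q.eval 0 = d1) (hQ1 : α * Q.eval 1 = d2)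
    (S' : Finset ℕ) (hcard : S'.card = t)
    (nd : ℕ → ZMod p) (hnd : ∀ j, nd j = ((t + j - 1 : ℕ) : ZMod p))
    (hinj : Set.InjOn nd ↑S')
    (lam : ℕ → ZMod p → ZMod p)
    (hlam : ∀ j ∈ S', ∀ e : ZMod p,
      lam j e = ∏ j' ∈ S'.erase j, (e - nd j') / (nd j - nd j')) :
    (∑ i, (u.1 * (s i).1 + u.2 * (s i).2 + x i) * y i)
        - u.1 * (∑ j ∈ S', lam j 0 * Q.eval (nd j))
        - u.2 * α * (∑ j ∈ S', lam j 1 * Q.eval (nd j))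
      = ∑ i, x i * y i := by
  have hQ : Q.degree < S'.card :=
    Polynomial.degree_le_natDegree.trans_lt (by exact_mod_cast (by omega : Q.natDegree < S'.card))
  have hsum (e : ZMod p) : ∑ j ∈ S', lam j e * Q.eval (nd j) = Q.eval e := by
    rw [← sum_lagrange_coeff_mul_eval hinj hQ e]
    exact Finset.sum_congr rfl fun j hj => by rw [hlam j hj e]
  rw [hsum, hsum, mul_assoc u.2, hQ0, hQ1, hd1, hd2, Finset.mul_sum, Finset.mul_sum,
    ← Finset.sum_sub_distrib, ← Finset.sum_sub_distrib]
  exact Finset.sum_congr rfl fun i _ => by ring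
end

section
/- Let G be a commutative group, p a prime, and g ∈ G with orderOf g = p; for a ∈ ZMod p write g^a for g raised to the canonical representative a.val ∈ {0,…,p−1}. Let n and t be positive integers, u = (u_1, u_2) ∈ (ZMod p)², s_1,…,s_n ∈ (ZMod p)², x, y ∈ (ZMod p)^n, d = (d_1, d_2) = Σ_{i=1}^n y_i·s_i, α ∈ ZMod p with α ≠ 0, and Q a polynomial over ZMod p of degree at most t − 1 with Q(0) = d_1 and α·Q(1) = d_2. Let S′ ⊆ ℕ be a finite set with |S′| = t whose nodes n_j = ((t + j − 1 : ℕ) : ZMod p) are pairwise distinct, and let λ_j(e) = Π_{j′∈S′, j′≠j} (e − n_{j′})/(n_j − n_{j′}). Define the ciphertexts ct_i = g^(u_1·(s_i)_1 + u_2·(s_i)_2 + x_i), the aggregate ct_0′ = Π_{i=1}^n ct_i^{(y_i).val}, and the partial decryptions ct_{j,1}′ = g^(u_1·λ_j(0)·Q(n_j)) and ct_{j,2}′ = g^(u_2·α·λ_j(1)·Q(n_j)). Then ct_0′ · (Π_{j∈S′} ct_{j,1}′)⁻¹ · (Π_{j∈S′} ct_{j,2}′)⁻¹ = g^(Σ_{i=1}^n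 x_i·y_i). -/
theorem pow_val_add {M : Type*} [Monoid M] {p : ℕ} [NeZero p] {g : M} (hg : g ^ p = 1)
    (a b : ZMod p) : g ^ (a + b).val = g ^ a.val * g ^ b.val := by
  rw [ZMod.val_add, ← pow_eq_pow_mod _ hg, pow_add]

theorem pow_val_mul {M : Type*} [Monoid M] {p : ℕ} {g : M} (hg : g ^ p = 1)
    (a b : ZMod p) : g ^ (a * b).val = (g ^ a.val) ^ b.val := by
  rw [ZMod.val_mul, ← pow_eq_pow_mod _ hg, pow_mul]

theorem pow_val_sum {M ι : Type*} [CommMonoid M] {p : ℕ} [NeZero p] {g : M} (hg : g ^ p = 1)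
    (S : Finset ι) (f : ι → ZMod p) :
    g ^ (∑ i ∈ S, f i).val = ∏ i ∈ S, g ^ (f i).val := by
  classical
  induction S using Finset.induction_on with
  | empty => simp
  | insert i S hi ih => rw [Finset.sum_insert hi, Finset.prod_insert hi, pow_val_add hg, ih]

/-- Lagrange interpolation in evaluated form: a polynomial of degree less than the number of
nodes is recovered at any point from its values at the nodes. -/
theorem sum_prod_erase_div_mul_eval_eq_eval {F ι : Type*} [Field F] [DecidableEq ι]
    {S : Finset ι} {v : ι → F} (hv : Set.InjOn v S) {Q : Polynomial F}
    (hQ : Q.degree < S.card) (e : F) :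
    ∑ j ∈ S, (∏ k ∈ S.erase j, (e - v k) / (v j - v k)) * Q.eval (v j) = Q.eval e := by
  conv_rhs => rw [Lagrange.eq_interpolate hv hQ, Lagrange.interpolate_apply]
  simp only [Polynomial.eval_finsetSum, Polynomial.eval_mul, Polynomial.eval_C, Lagrange.basis,
    Polynomial.eval_prod, Lagrange.basisDivisor, Polynomial.eval_sub, Polynomial.eval_X]
  refine Finset.sum_congr rfl fun j _ => ?_
  rw [mul_comm]
  congr 1
  exact Finset.prod_congr rfl fun k _ => by rw [div_eq_inv_mul]


/-- Correctness of the CombineRecover algorithm of the VTMCFE scheme: in a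
commutative group `G` with `g` of order `p`, writing `g^a` for `g ^ a.val` (`a : ZMod p`),
the combination of the aggregated ciphertext `ct_0′ = Π_i ct_i^{y_i}` (where
`ct_i = g^(u_1·(s_i)_1 + u_2·(s_i)_2 + x_i)`) with the partial decryptions
`ct_{j,1}′ = g^(u_1·λ_j(0)·Q(n_j))` and `ct_{j,2}′ = g^(u_2·α·λ_j(1)·Q(n_j))` of any `t`
decryptors recovers `g^(Σ_i x_i·y_i)`. -/
theorem vtmcfe_combine_recover_correct {G : Type*} [CommGroup G]
    (p : ℕ) [Fact p.Prime]
    (g : G) (hg : orderOf g = p)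
    (n t : ℕ) (hn : 0 < n) (ht : 0 < t)
    (u : ZMod p × ZMod p) (s : Fin n → ZMod p × ZMod p)
    (x y : Fin n → ZMod p)
    (d1 d2 : ZMod p)
    (hd1 : d1 = ∑ i, y i * (s i).1) (hd2 : d2 = ∑ i, y i * (s i).2)
    (α : ZMod p) (hα : α ≠ 0)
    (Q : Polynomial (ZMod p)) (hQdeg : Q.natDegree ≤ t - 1)
    (hQ0 : Q.eval 0 = d1) (hQ1 : α * Q.eval 1 = d2)
    (S' : Finset ℕ) (hcard : S'.card = t)
    (nd : ℕ → ZMod p) (hnd : ∀ j, nd j = ((t + j - 1 : ℕ) : ZMod p))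
    (hinj : Set.InjOn nd ↑S')
    (lam : ℕ → ZMod p → ZMod p)
    (hlam : ∀ j ∈ S', ∀ e : ZMod p,
      lam j e = ∏ j' ∈ S'.erase j, (e - nd j') / (nd j - nd j'))
    (ct : Fin n → G)
    (hct : ∀ i, ct i = g ^ (u.1 * (s i).1 + u.2 * (s i).2 + x i).val)
    (ct0 : G) (hct0 : ct0 = ∏ i, (ct i) ^ (y i).val)
    (ct1 ct2 : ℕ → G)
    (hct1 : ∀ j ∈ S', ct1 j = g ^ (u.1 * lam j 0 * Q.eval (nd j)).val)
    (hct2 : ∀ j ∈ S', ct2 j = g ^ (u.2 * α * lam j 1 * Q.eval (nd j)).val) :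
    ct0 * (∏ j ∈ S', ct1 j)⁻¹ * (∏ j ∈ S', ct2 j)⁻¹
      = g ^ (∑ i, x i * y i).val := by
  have hgp : g ^ p = 1 := by rw [← hg, pow_orderOf_eq_one]
  have hdeg : Q.degree < S'.card :=
    Polynomial.degree_le_natDegree.trans_lt (by exact_mod_cast (by omega))
  have hinterp (e : ZMod p) : ∑ j ∈ S', lam j e * Q.eval (nd j) = Q.eval e := by
    rw [← sum_prod_erase_div_mul_eval_eq_eval hinj hdeg e]
    exact Finset.sum_congr rfl fun j hj => by rw [hlam j hj]
  have h1 : ∏ j ∈ S', ct1 j = g ^ (u.1 * d1).val := by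
    rw [Finset.prod_congr rfl hct1, ← pow_val_sum hgp, ← hQ0, ← hinterp 0]
    simp only [Finset.mul_sum, mul_assoc]
  have h2 : ∏ j ∈ S', ct2 j = g ^ (u.2 * d2).val := by
    rw [Finset.prod_congr rfl hct2, ← pow_val_sum hgp, ← hQ1, ← hinterp 1]
    simp only [Finset.mul_sum, mul_assoc]
  have h0 : ct0 = g ^ (∑ i, x i * y i + u.2 * d2 + u.1 * d1).val := by
    simp only [hct0, hct, ← pow_val_mul hgp]
    rw [← pow_val_sum hgp, hd1, hd2, Finset.mul_sum, Finset.mul_sum, ← Finset.sum_add_distrib,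
      ← Finset.sum_add_distrib]
    congr 2
    exact Finset.sum_congr rfl fun i _ => by ring
  rw [h0, h1, h2, pow_val_add hgp, pow_val_add hgp, mul_inv_cancel_right, mul_inv_cancel_right]
end

section
/- Let G be a commutative group whose cardinality is a prime p, let g, h, y, T, a_1, a_2 ∈ G, and let z, z′, c, c′ ∈ ℤ with (p : ℤ) not dividing (c − c′). Suppose both transcripts verify: g^z = a_1·y^c, h^z = a_2·T^c, g^{z′} = a_1·y^{c′}, and h^{z′} = a_2·T^{c′}. Then there exists x ∈ ℤ such that y = g^x and T = h^x; that is, the Chaum–Pedersen protocol has special soundness: two accepting transcripts with the same commitment and distinct challenges modulo p witness that y and T have equal discrete logarithms with respect to g and h. -/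
/-- Two accepting Schnorr transcripts with the same commitment `a` determine the witness
`v * (z - z')`, where `v` inverts the difference of the challenges modulo the exponent `n`. -/
theorem eq_zpow_of_accepting_transcripts {G : Type*} [CommGroup G] {g y a : G}
    {n u v z z' c c' : ℤ} (hy : y ^ n = 1) (huv : u * n + v * (c - c') = 1)
    (h : g ^ z = a * y ^ c) (h' : g ^ z' = a * y ^ c') :
    y = g ^ (v * (z - z')) := by
  have hdiff : g ^ (z - z') = y ^ (c - c') := by
    rw [zpow_sub, zpow_sub, h, h', ← div_eq_mul_inv, ← div_eq_mul_inv, mul_div_mul_left_eq_div]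
  calc
    y = y ^ (u * n + v * (c - c')) := by rw [huv, zpow_one]
    _ = g ^ (v * (z - z')) := by
      rw [zpow_add, zpow_mul', hy, one_zpow, one_mul, zpow_mul', ← hdiff, ← zpow_mul']

/-- Special soundness of the Chaum–Pedersen DLEQ protocol: in a commutative
group of prime cardinality `p`, two accepting transcripts `(a_1, a_2, z, c)` and
`(a_1, a_2, z′, c′)` with the same commitment and challenges distinct modulo `p` witness
that `y` and `T` have equal discrete logarithms with respect to `g` and `h`. -/
theorem chaum_pedersen_special_soundness {G : Type*} [CommGroup G]
    (p : ℕ) (hp : p.Prime) (hG : Nat.card G = p)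
    (g h y T a1 a2 : G) (z z' c c' : ℤ)
    (hcc : ¬ ((p : ℤ) ∣ (c - c')))
    (h1 : g ^ z = a1 * y ^ c) (h2 : h ^ z = a2 * T ^ c)
    (h3 : g ^ z' = a1 * y ^ c') (h4 : h ^ z' = a2 * T ^ c') :
    ∃ x : ℤ, y = g ^ x ∧ T = h ^ x := by
  have hpow (w : G) : w ^ (p : ℤ) = 1 := by
    rw [zpow_natCast, ← hG, pow_card_eq_one']
  obtain ⟨u, v, huv⟩ : IsCoprime (p : ℤ) (c - c') :=
    (Nat.prime_iff_prime_int.mp hp).coprime_iff_not_dvd.mpr hcc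
  exact ⟨v * (z - z'), eq_zpow_of_accepting_transcripts (hpow y) huv h1 h3,
    eq_zpow_of_accepting_transcripts (hpow T) huv h2 h4⟩
end

section
/- Let G be a group, p a prime, and g, h ∈ G with g^p = 1 and h^p = 1; for a ∈ ZMod p write g^a for g raised to the canonical representative a.val. Fix x, c ∈ ZMod p and set y = g^x and T = h^x. Then the distribution of real Chaum–Pedersen transcripts equals the distribution of simulated transcripts: the pushforward of the uniform probability mass function on ZMod p under r ↦ (g^r, h^r, r + c·x) equals its pushforward under z ↦ (g^z · (y^c)⁻¹, h^z · (T^c)⁻¹, z), as probability mass functions on G × G × ZMod p. -/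
theorem PMF.map_equiv_uniformOfFintype {α β : Type*} [Fintype α] [Nonempty α] [Fintype β]
    [Nonempty β] (e : α ≃ β) : (PMF.uniformOfFintype α).map e = PMF.uniformOfFintype β := by
  classical
  ext b
  rw [PMF.map_apply, tsum_eq_single (e.symm b)]
  · simp [Fintype.card_congr e]
  · intro a ha
    rw [if_neg]
    rintro rfl
    exact ha (e.symm_apply_apply a).symm

theorem pow_zmod_val_add {M : Type*} [Monoid M] {n : ℕ} [NeZero n] {g : M} (hg : g ^ n = 1)
    (a b : ZMod n) : g ^ (a + b).val = g ^ a.val * g ^ b.val := by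
  rw [ZMod.val_add, ← pow_eq_pow_mod _ hg, pow_add]

theorem pow_zmod_val_mul {M : Type*} [Monoid M] {n : ℕ} {g : M} (hg : g ^ n = 1)
    (a b : ZMod n) : g ^ (a * b).val = (g ^ a.val) ^ b.val := by
  rw [ZMod.val_mul, ← pow_eq_pow_mod _ hg, pow_mul]

theorem pow_zmod_val_add_mul_mul_inv {G : Type*} [Group G] {n : ℕ} [NeZero n] {g : G}
    (hg : g ^ n = 1) (r c x : ZMod n) :
    g ^ (r + c * x).val * ((g ^ x.val) ^ c.val)⁻¹ = g ^ r.val := by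
  rw [pow_zmod_val_add hg, mul_comm c x, pow_zmod_val_mul hg, mul_inv_cancel_right]

/-- Honest-verifier zero-knowledge of the Chaum–Pedersen DLEQ protocol:
for `g, h` with `g^p = h^p = 1` (`p` prime), writing `g^a := g ^ a.val` for `a : ZMod p`,
and fixing `x, c : ZMod p`, `y = g^x`, `T = h^x`, the distribution of real transcripts
`(g^r, h^r, r + c·x)` for uniformly random `r` equals the distribution of simulated
transcripts `(g^z·(y^c)⁻¹, h^z·(T^c)⁻¹, z)` for uniformly random `z`, as probability
mass functions on `G × G × ZMod p`. -/
theorem chaum_pedersen_hvzk {G : Type*} [Group G]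
    (p : ℕ) [Fact p.Prime]
    (g h : G) (hgp : g ^ p = 1) (hhp : h ^ p = 1)
    (x c : ZMod p) (y T : G)
    (hy : y = g ^ x.val) (hT : T = h ^ x.val) :
    (PMF.uniformOfFintype (ZMod p)).map
        (fun r : ZMod p =>
          ((g ^ r.val, h ^ r.val, r + c * x) : G × G × ZMod p))
      = (PMF.uniformOfFintype (ZMod p)).map
        (fun z : ZMod p =>
          ((g ^ z.val * (y ^ c.val)⁻¹, h ^ z.val * (T ^ c.val)⁻¹, z) : G × G × ZMod p)) := by
  subst hy hT
  conv_rhs => rw [← PMF.map_equiv_uniformOfFintype (Equiv.addRight (c * x)), PMF.map_comp]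
  congr 1
  funext r
  simp [pow_zmod_val_add_mul_mul_inv hgp, pow_zmod_val_add_mul_mul_inv hhp]
end

section
/- Let F be a field, let u, a⊥ ∈ F² with u ⬝ a⊥ ≠ 0, and set γ = −(u ⬝ a⊥)⁻¹. Let n be a positive integer, s_1,…,s_n ∈ F², x⁰, x¹ ∈ F^n, and define s_i′ = s_i + (γ·(x¹_i − x⁰_i))·a⊥ for each i. Then: (i) for every i, u ⬝ s_i′ + x¹_i = u ⬝ s_i + x⁰_i; (ii) for every y ∈ F^n with Σ_{i=1}^n y_i·(x¹_i − x⁰_i) = 0, one has Σ_{i=1}^n y_i·s_i′ = Σ_{i=1}^n y_i·s_i; (iii) for every v ∈ F² with v ⬝ a⊥ = 0 and every i, v ⬝ s_i′ = v ⬝ s_i. -/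
/-- The key substitution lemma of the hybrid security proof of the MCFE
scheme: for `u, a⊥ ∈ F²` with `u ⬝ a⊥ ≠ 0`, `γ = −(u ⬝ a⊥)⁻¹`, and
`s_i′ = s_i + (γ·(x¹_i − x⁰_i))·a⊥`, (i) ciphertext exponents encrypting `x¹_i` under
`s_i′` equal those encrypting `x⁰_i` under `s_i`; (ii) functional keys `Σ_i y_i·s_i` are
unchanged whenever `Σ_i y_i·(x¹_i − x⁰_i) = 0`; (iii) `v ⬝ s_i′ = v ⬝ s_i` whenever
`v ⬝ a⊥ = 0`. -/
theorem mcfe_key_substitution {F : Type*} [Field F]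
    (u aperp : F × F) (hu : u.1 * aperp.1 + u.2 * aperp.2 ≠ 0)
    (γ : F) (hγ : γ = -(u.1 * aperp.1 + u.2 * aperp.2)⁻¹)
    (n : ℕ) (hn : 0 < n)
    (s : Fin n → F × F) (x0 x1 : Fin n → F)
    (s' : Fin n → F × F)
    (hs' : ∀ i, s' i = s i + (γ * (x1 i - x0 i)) • aperp) :
    (∀ i, u.1 * (s' i).1 + u.2 * (s' i).2 + x1 i
        = u.1 * (s i).1 + u.2 * (s i).2 + x0 i) ∧
    (∀ y : Fin n → F, (∑ i, y i * (x1 i - x0 i)) = 0 →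
        ∑ i, y i • s' i = ∑ i, y i • s i) ∧
    (∀ v : F × F, v.1 * aperp.1 + v.2 * aperp.2 = 0 →
        ∀ i, v.1 * (s' i).1 + v.2 * (s' i).2 = v.1 * (s i).1 + v.2 * (s i).2) := by
  have hγu : γ * (u.1 * aperp.1 + u.2 * aperp.2) = -1 := by
    rw [hγ, neg_mul, inv_mul_cancel₀ hu]
  refine ⟨fun i => ?_, fun y hy => ?_, fun v hv i => ?_⟩
  · simp only [hs', Prod.fst_add, Prod.snd_add, Prod.smul_fst, Prod.smul_snd, smul_eq_mul]
    linear_combination (x1 i - x0 i) * hγu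
  · have hshift : ∀ i, y i • s' i = y i • s i + (γ * (y i * (x1 i - x0 i))) • aperp := fun i => by
      rw [hs', smul_add, smul_smul, mul_left_comm]
    simp only [hshift, Finset.sum_add_distrib, ← Finset.sum_smul, ← Finset.mul_sum, hy,
      mul_zero, zero_smul, add_zero]
  · simp only [hs', Prod.fst_add, Prod.snd_add, Prod.smul_fst, Prod.smul_snd, smul_eq_mul]
    linear_combination γ * (x1 i - x0 i) * hv
end
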